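/- Let g be a k-monotone probability density with mixing distribution F, i.e. g(x) = ∫₀^∞ (k/t^k)(t−x)₊^{k−1} dF(t), and suppose F(∞) = ∫₀^∞ g(x)dx = 1. Then at every continuity point t > 0 of F, F(t) = G(t) − t g(t) + t²g'(t)/2! − ⋯ + (−1)^{k−1} t^{k−1} g^{(k−2)}(t)/(k−1)! + (−1)^k t^k g^{(k−1)}(t)/k!, where G(t) = ∫₀^t g(x) dx. -/

import Mathlib

open MeasureTheory

noncomputable def kmKer (k m : ℕ) (x s : ℝ) : ℝ := if x < s then (s - x) ^ m / s ^ k else 0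

lemma kmKer_measurable (k m : ℕ) (x : ℝ) : Measurable (kmKer k m x) := by
  unfold kmKer
  exact Measurable.ite measurableSet_Ioi (by fun_prop) measurable_const

lemma km_bnd {k m : ℕ} (h : m ≤ k) {c s : ℝ} (hc : 0 < c) (hs : c ≤ s) :
    s ^ m / s ^ k ≤ 1 / c ^ (k - m) := by
  have hs0 : 0 < s := hc.trans_le hs
  have : s ^ k = s ^ m * s ^ (k - m) := by rw [← pow_add]; congr 1; omega
  rw [this, ← div_div, div_self (by positivity)]
  gcongr

lemma kmKer_nonneg {k m : ℕ} {x s : ℝ} (hx : 0 ≤ x) : 0 ≤ kmKer k m x s := by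
  unfold kmKer
  split_ifs with h
  · have : 0 < s := hx.trans_lt h
    have : 0 < s - x := by linarith
    positivity
  · rfl

lemma kmKer_le {k m : ℕ} (h : m ≤ k) {x s : ℝ} (hx : 0 < x) :
    kmKer k m x s ≤ 1 / x ^ (k - m) := by
  unfold kmKer
  split_ifs with hs
  · refine le_trans ?_ (km_bnd h hx hs.le)
    have : 0 < s := hx.trans hs
    gcongr
    linarith
  · positivity

lemma kmKer_integrable {k m : ℕ} (h : m ≤ k) (F : Measure ℝ) [IsProbabilityMeasure F]
    {x : ℝ} (hx : 0 < x) : Integrable (kmKer k m x) F := by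
  refine Integrable.of_bound (C := 1 / x ^ (k - m)) (kmKer_measurable k m x).aestronglyMeasurable ?_
  refine Filter.Eventually.of_forall fun s => ?_
  rw [Real.norm_of_nonneg (kmKer_nonneg hx.le)]
  exact kmKer_le h hx

lemma kmKer_eq_max (k m : ℕ) (x s : ℝ) :
    kmKer k (m + 1) x s = (max (s - x) 0) ^ (m + 1) / s ^ k := by
  unfold kmKer
  split_ifs with h
  · rw [max_eq_left (by linarith)]
  · rw [max_eq_right (by linarith)]; simp

lemma kmKer_lip {k m : ℕ} (h : m ≤ k) {c s x y : ℝ} (hc : 0 < c) (hx : c ≤ x) (hy : c ≤ y) :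
    |kmKer k (m + 1) x s - kmKer k (m + 1) y s| ≤ ((m + 1) / c ^ (k - m)) * |x - y| := by
  rw [kmKer_eq_max, kmKer_eq_max]
  rcases le_or_gt s c with hs | hs
  · rw [max_eq_right (by linarith), max_eq_right (by linarith)]; simp; positivity
  · have hs0 : 0 < s := hc.trans hs
    rw [← sub_div, abs_div, abs_of_pos (pow_pos hs0 k)]
    have h1 := abs_pow_sub_pow_le (max (s - x) 0) (max (s - y) 0) (m + 1)
    have h2 : |max (s - x) 0 - max (s - y) 0| ≤ |x - y| := by
      refine (abs_max_sub_max_le_abs _ _ _).trans ?_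
      rw [show s - x - (s - y) = -(x - y) by ring, abs_neg]
    have h3 : max |max (s - x) 0| |max (s - y) 0| ≤ s := by
      rw [abs_of_nonneg (le_max_right _ _), abs_of_nonneg (le_max_right _ _)]
      refine max_le (max_le ?_ hs0.le) (max_le ?_ hs0.le) <;> linarith
    have h4 : |max (s - x) 0 ^ (m + 1) - max (s - y) 0 ^ (m + 1)|
        ≤ |x - y| * ((m + 1 : ℕ) : ℝ) * s ^ m := by
      refine h1.trans ?_
      rw [Nat.add_sub_cancel]
      gcongr
    have h5 := km_bnd h hc hs.le
    calc _ ≤ |x - y| * ((m + 1 : ℕ) : ℝ) * s ^ m / s ^ k := by gcongr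
      _ = |x - y| * ((m + 1 : ℕ) : ℝ) * (s ^ m / s ^ k) := by ring
      _ ≤ |x - y| * ((m + 1 : ℕ) : ℝ) * (1 / c ^ (k - m)) := by gcongr
      _ = _ := by push_cast; ring

lemma kmPoly_deriv (k m : ℕ) (x s : ℝ) :
    HasDerivAt (fun y => (s - y) ^ (m + 1) / s ^ k) (-(m + 1) * ((s - x) ^ m / s ^ k)) x := by
  have h := (((hasDerivAt_id x).const_sub s).pow (m + 1)).div_const (s ^ k)
  refine h.congr_deriv ?_
  simp only [id, Nat.add_sub_cancel]
  push_cast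
  ring

lemma kmKer_deriv {k m : ℕ} {x s : ℝ} (h : 1 ≤ m ∨ s ≠ x) :
    HasDerivAt (fun y => kmKer k (m + 1) y s) (-(m + 1) * kmKer k m x s) x := by
  rcases lt_trichotomy x s with hs | hs | hs
  · have : kmKer k m x s = (s - x) ^ m / s ^ k := by simp [kmKer, hs]
    rw [this]
    refine (kmPoly_deriv k m x s).congr_of_eventuallyEq ?_
    filter_upwards [Iio_mem_nhds hs] with y hy
    simp only [Set.mem_Iio] at hy
    simp [kmKer, hy]
  · subst hs
    have hm : 1 ≤ m := by simpa using h
    have h0 : kmKer k m x x = 0 := by simp [kmKer]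
    rw [h0, mul_zero]
    have h1 : HasDerivWithinAt (fun y => kmKer k (m + 1) y x) 0 (Set.Iic x) x := by
      have h2 := (kmPoly_deriv k m x x).hasDerivWithinAt (s := Set.Iic x)
      rw [sub_self, zero_pow (by omega), zero_div, mul_zero] at h2
      refine h2.congr ?_ ?_
      · intro y hy
        rw [kmKer_eq_max, max_eq_left (by simpa using hy)]
      · simp [kmKer]
    have h2 : HasDerivWithinAt (fun y => kmKer k (m + 1) y x) 0 (Set.Ici x) x := by
      refine (hasDerivWithinAt_const x (Set.Ici x) (0:ℝ)).congr ?_ ?_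
      · intro y hy
        have : ¬ y < x := not_lt.mpr hy
        simp [kmKer, this]
      · simp [kmKer]
    have h3 := h1.union h2
    rw [Set.Iic_union_Ici] at h3
    exact h3.hasDerivAt Filter.univ_mem
  · have : kmKer k m x s = 0 := by simp [kmKer, hs.le]
    rw [this, mul_zero]
    refine (hasDerivAt_const x (0:ℝ)).congr_of_eventuallyEq ?_
    filter_upwards [Ioi_mem_nhds hs] with y hy
    have : ¬ y < s := not_lt.mpr (le_of_lt hy)
    simp [kmKer, this]

noncomputable def kmD (F : Measure ℝ) (k m : ℕ) (x : ℝ) : ℝ := ∫ s, kmKer k m x s ∂F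

lemma kmD_deriv (F : Measure ℝ) [IsProbabilityMeasure F] {k m : ℕ} (hm : m + 1 ≤ k)
    {x : ℝ} (hx : 0 < x) (h : 1 ≤ m ∨ F {x} = 0) :
    HasDerivAt (kmD F k (m + 1)) (-(m + 1) * kmD F k m x) x := by
  have key := hasDerivAt_integral_of_dominated_loc_of_lip (μ := F)
    (F := fun y s => kmKer k (m + 1) y s)
    (F' := fun s => -(m + 1) * kmKer k m x s) (x₀ := x) (s := Set.Ioi (x / 2))
    (bound := fun _ => (m + 1) / (x / 2) ^ (k - m))
    (Ioi_mem_nhds (by linarith))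
    (Filter.Eventually.of_forall fun y => (kmKer_measurable k (m + 1) y).aestronglyMeasurable)
    (kmKer_integrable hm F hx)
    ((kmKer_measurable k m x).const_mul _).aestronglyMeasurable
    (Filter.Eventually.of_forall fun s => by
      refine LipschitzOnWith.of_dist_le_mul fun y hy z hz => ?_
      have hb : (0:ℝ) ≤ (m + 1) / (x / 2) ^ (k - m) := by positivity
      rw [Real.dist_eq, Real.dist_eq, Real.coe_nnabs, abs_of_nonneg hb]
      exact kmKer_lip (show m ≤ k by omega) (by linarith) (le_of_lt hy) (le_of_lt hz))
    (integrable_const _)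
    (by
      rcases h with h | h
      · exact Filter.Eventually.of_forall fun s => kmKer_deriv (Or.inl h)
      · have : ∀ᵐ s ∂F, s ≠ x := by
          rw [ae_iff]; simpa using h
        filter_upwards [this] with s hs
        exact kmKer_deriv (Or.inr hs))
  have := key.2
  rw [integral_const_mul] at this
  exact this

lemma km_iter (F : Measure ℝ) [IsProbabilityMeasure F] {k : ℕ} (g : ℝ → ℝ)
    (hg : ∀ x, 0 < x → g x = k * kmD F k (k - 1) x) (j : ℕ) (hj : j < k) :
    ∀ x, 0 < x → (j + 1 < k ∨ F {x} = 0) →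
      iteratedDeriv j g x = (-1) ^ j * (k.descFactorial (j + 1) : ℝ) * kmD F k (k - 1 - j) x := by
  induction j with
  | zero => intro x hx _; simp [hg x hx]
  | succ j ih =>
    intro x hx h
    have ih' := ih (by omega)
    rw [iteratedDeriv_succ]
    have he : iteratedDeriv j g =ᶠ[nhds x]
        fun y => (-1) ^ j * (k.descFactorial (j + 1) : ℝ) * kmD F k (k - 1 - j) y := by
      filter_upwards [Ioi_mem_nhds hx] with y hy
      exact ih' y hy (Or.inl hj)
    rw [he.deriv_eq]
    obtain ⟨m, hm⟩ : ∃ m, k = j + 1 + (m + 1) := ⟨k - j - 2, by omega⟩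
    have e1 : k - 1 - j = m + 1 := by omega
    have e2 : k - 1 - (j + 1) = m := by omega
    have e3 : k - (j + 1) = m + 1 := by omega
    rw [e1, e2]
    have hd := kmD_deriv F (k := k) (m := m) (by omega) hx
      (h.imp (fun h => by omega) id)
    rw [(hd.const_mul _).deriv, Nat.descFactorial_succ k (j + 1), e3]
    push_cast
    ring

lemma kmD_contOn (F : Measure ℝ) [IsProbabilityMeasure F] (hpos : ∀ᵐ s ∂F, 0 < s)
    {k : ℕ} (hk : 1 ≤ k) (t : ℝ) : ContinuousOn (kmD F k k) (Set.Icc 0 t) := by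
  refine continuousOn_of_dominated (bound := fun _ => 1)
    (fun x _ => (kmKer_measurable k k x).aestronglyMeasurable) ?_ (integrable_const _) ?_
  · intro x hx
    filter_upwards [hpos] with s hs
    rw [Real.norm_of_nonneg (kmKer_nonneg hx.1)]
    unfold kmKer
    split_ifs with h
    · rw [div_le_one (by positivity)]
      have := hx.1
      gcongr
      linarith
    · norm_num
  · filter_upwards with s
    obtain ⟨m, rfl⟩ : ∃ m, k = m + 1 := ⟨k - 1, by omega⟩
    simp only [kmKer_eq_max]
    fun_prop

theorem kMonotone_inversion_formula
    (k : ℕ) (hk : 2 ≤ k)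
    (F : Measure ℝ) [IsProbabilityMeasure F] (hF0 : F (Set.Iic 0) = 0)
    (g : ℝ → ℝ)
    (hg : ∀ x : ℝ, 0 < x →
      g x = ∫ t in Set.Ioi (0:ℝ), (k / t ^ k) * (max (t - x) 0) ^ (k - 1) ∂F)
    (t : ℝ) (ht : 0 < t) (hcont : F {t} = 0) :
    (F (Set.Iic t)).toReal
      = (∫ x in Set.Ioc (0:ℝ) t, g x) +
        ∑ j ∈ Finset.range k,
          (-1 : ℝ) ^ (j + 1) * t ^ (j + 1) * iteratedDeriv j g t / (j + 1).factorial := by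
  have hpos : ∀ᵐ s ∂F, 0 < s := by
    rw [ae_iff]; simpa [Set.Iic] using hF0
  have hg' : ∀ x, 0 < x → g x = k * kmD F k (k - 1) x := by
    intro x hx
    rw [hg x hx, Measure.restrict_eq_self_of_ae_mem (s := Set.Ioi 0) hpos, kmD, ← integral_const_mul]
    congr 1
    ext s
    obtain ⟨m, rfl⟩ : ∃ m, k = m + 2 := ⟨k - 2, by omega⟩
    rw [show m + 2 - 1 = m + 1 by omega, kmKer_eq_max]
    ring
  have hD0 : kmD F k k 0 = 1 := by
    have : kmD F k k 0 = ∫ s, (1:ℝ) ∂F := by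
      refine integral_congr_ae ?_
      filter_upwards [hpos] with s hs
      simp [kmKer, hs, (pow_pos hs k).ne']
    rw [this]; simp
  have hder : ∀ x ∈ Set.Ioo 0 t, HasDerivAt (fun y => - kmD F k k y) (g x) x := by
    intro x hx
    obtain ⟨m, rfl⟩ : ∃ m, k = m + 1 := ⟨k - 1, by omega⟩
    have := (kmD_deriv F (k := m + 1) (m := m) le_rfl hx.1 (Or.inl (by omega))).neg
    refine HasDerivAt.congr_deriv (f := fun y => - kmD F (m + 1) (m + 1) y) this ?_
    rw [hg' x hx.1, Nat.add_sub_cancel]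
    push_cast
    ring
  have hc := (kmD_contOn F hpos (k := k) (by omega) t).neg
  have hint : IntegrableOn g (Set.Ioc 0 t) := by
    refine intervalIntegral.integrableOn_deriv_of_nonneg hc hder ?_
    intro x hx
    rw [hg' x hx.1]
    have : 0 ≤ kmD F k (k - 1) x := integral_nonneg fun s => kmKer_nonneg hx.1.le
    positivity
  have hG : ∫ x in Set.Ioc (0:ℝ) t, g x = 1 - kmD F k k t := by
    rw [← intervalIntegral.integral_of_le ht.le,
      intervalIntegral.integral_eq_sub_of_hasDerivAt_of_le ht.le hc hder
        ((intervalIntegrable_iff_integrableOn_Ioc_of_le ht.le).2 hint)]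
    change - kmD F k k t - - kmD F k k 0 = _
    rw [hD0]
    ring
  have hsum : ∑ j ∈ Finset.range k,
      (-1 : ℝ) ^ (j + 1) * t ^ (j + 1) * iteratedDeriv j g t / (j + 1).factorial
      = - ∑ j ∈ Finset.range k, t ^ (j + 1) * (k.choose (j + 1)) * kmD F k (k - (j + 1)) t := by
    rw [← Finset.sum_neg_distrib]
    refine Finset.sum_congr rfl fun j hj => ?_
    rw [km_iter F g hg' j (Finset.mem_range.1 hj) t ht (Or.inr hcont),
      Nat.descFactorial_eq_factorial_mul_choose, show k - 1 - j = k - (j + 1) by omega]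
    have hf : ((j + 1).factorial : ℝ) ≠ 0 := by positivity
    have h1 : (-1 : ℝ) ^ j * (-1) ^ j = 1 := by rw [← mul_pow]; simp
    push_cast
    rw [div_eq_iff hf, pow_succ (-1 : ℝ) j]
    linear_combination (-(t ^ (j + 1)) * (j + 1).factorial * (k.choose (j + 1)) *
      kmD F k (k - (j + 1)) t) * h1
  have hbin : ∑ i ∈ Finset.range (k + 1), t ^ i * (k.choose i) * kmD F k (k - i) t
      = F.real (Set.Ioi t) := by
    have : ∀ i ∈ Finset.range (k + 1), t ^ i * (k.choose i) * kmD F k (k - i) t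
        = ∫ s, t ^ i * (k.choose i) * kmKer k (k - i) t s ∂F := by
      intro i _
      rw [integral_const_mul, kmD]
    rw [Finset.sum_congr rfl this, ← integral_finsetSum _
      (fun i _ => (kmKer_integrable (by omega) F ht).const_mul _),
      ← integral_indicator_one measurableSet_Ioi]
    congr 1
    ext s
    by_cases hs : t < s
    · have hs0 : s ^ k ≠ 0 := (pow_pos (ht.trans hs) k).ne'
      have ha := add_pow t (s - t) k
      rw [add_sub_cancel] at ha
      simp only [kmKer, hs, if_true, Set.indicator, Set.mem_Ioi, Pi.one_apply]
      rw [← div_self hs0]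
      nth_rewrite 2 [ha]
      rw [Finset.sum_div]
      refine Finset.sum_congr rfl fun i _ => ?_
      ring
    · simp [kmKer, hs]
  have hcompl : (F (Set.Iic t)).toReal = 1 - F.real (Set.Ioi t) := by
    rw [← Set.compl_Iic, probReal_compl_eq_one_sub measurableSet_Iic]
    simp [Measure.real]
  rw [Finset.sum_range_succ'] at hbin
  simp only [pow_zero, Nat.choose_zero_right, Nat.cast_one, one_mul, Nat.sub_zero] at hbin
  rw [hcompl, hG, hsum, ← hbin]
  ring
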